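/- For every polyhedral decomposition 𝒫 of ℚ^n, the rescaled Hausdorff limit lim_{a→0⁺} aΞ exists for every Ξ ∈ 𝒫 (it is a point if Ξ is bounded and a strongly convex rational polyhedral cone otherwise), and the asymptotic fan Σ_𝒫 = { lim_{a→0⁺} aΞ : Ξ ∈ 𝒫 } is a complete fan in ℚ^n. -/

import Mathlib

noncomputable section

namespace TropDisc

open scoped BigOperators

abbrev QVec' (n : ℕ) : Type := Fin n → ℚ
abbrev RVec' (n : ℕ) : Type := Fin n → ℝ

def qr' {n : ℕ} (v : QVec' n) : RVec' n := fun i => (v i : ℝ)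

/-- The image of a set of rational vectors in `ℝ^n`. -/
def Qr {n : ℕ} (S : Set (QVec' n)) : Set (RVec' n) := qr' '' S

/-- The solution set in `ℚ^n` of a finite system of linear inequalities
`⟨m, ·⟩ ≥ c`, `m ∈ Hom(ℤ^n, ℤ)`, `c ∈ ℚ`. -/
def solSet {n : ℕ} (s : Finset ((Fin n → ℤ) × ℚ)) : Set (QVec' n) :=
  {x | ∀ c ∈ s, c.2 ≤ ∑ i, (c.1 i : ℚ) * x i}

/-- A rational polyhedron in `ℚ^n`. -/
def IsRatPolyhedron {n : ℕ} (P : Set (QVec' n)) : Prop := ∃ s, P = solSet s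

/-- `F` is a (nonempty) face of the rational polyhedron `P`: for some presentation of `P`,
`F` is the subset of `P` where some of the defining inequalities are equalities. -/
def IsFaceOf {n : ℕ} (P F : Set (QVec' n)) : Prop :=
  F.Nonempty ∧ ∃ s, P = solSet s ∧ ∃ t ⊆ s,
    F = {x | x ∈ P ∧ ∀ c ∈ t, (∑ i, (c.1 i : ℚ) * x i) = c.2}

/-- A strongly convex rational polyhedron: a rational polyhedron with a vertex
(a zero-dimensional, i.e. singleton, face). -/
def IsStronglyConvexPoly {n : ℕ} (P : Set (QVec' n)) : Prop :=
  IsRatPolyhedron P ∧ ∃ x, IsFaceOf P {x}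

/-- A polyhedral decomposition of `ℚ^n`: a finite covering by strongly convex rational
polyhedra, closed under taking (nonempty) faces, in which the intersection of any two members
is a common face of both. -/
def IsPolyDecomp {n : ℕ} (P : Set (Set (QVec' n))) : Prop :=
  P.Finite ∧ (∀ Ξ ∈ P, IsStronglyConvexPoly Ξ) ∧ (⋃₀ P = Set.univ) ∧
  (∀ Ξ ∈ P, ∀ F, IsFaceOf Ξ F → F ∈ P) ∧
  (∀ Ξ ∈ P, ∀ Ξ' ∈ P, (Ξ ∩ Ξ').Nonempty →
    IsFaceOf Ξ (Ξ ∩ Ξ') ∧ IsFaceOf Ξ' (Ξ ∩ Ξ'))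

/-- A rational polyhedral cone in `ℚ^n`. -/
def IsRatCone {n : ℕ} (C : Set (QVec' n)) : Prop :=
  ∃ s : Finset (Fin n → ℤ), C = {x | ∀ m ∈ s, 0 ≤ ∑ i, (m i : ℚ) * x i}

/-- A strongly convex rational polyhedral cone. -/
def IsStronglyConvexCone {n : ℕ} (C : Set (QVec' n)) : Prop :=
  IsRatCone C ∧ IsFaceOf C {0}

/-- A fan in `ℚ^n`. -/
def IsFan {n : ℕ} (F : Set (Set (QVec' n))) : Prop :=
  F.Finite ∧ (∀ C ∈ F, IsStronglyConvexCone C) ∧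
  (∀ C ∈ F, ∀ F', IsFaceOf C F' → F' ∈ F) ∧
  (∀ C ∈ F, ∀ C' ∈ F, (C ∩ C').Nonempty →
    IsFaceOf C (C ∩ C') ∧ IsFaceOf C' (C ∩ C'))

/-- A complete fan: the union of its cones is all of `ℚ^n`. -/
def IsCompleteFan {n : ℕ} (F : Set (Set (QVec' n))) : Prop :=
  IsFan F ∧ ⋃₀ F = Set.univ

/-- `C` is the Hausdorff limit of the rescalings `a·Ξ` as `a → 0⁺`: the Hausdorff
(extended) distance between `a·Ξ` and `C`, computed in `ℝ^n`, tends to `0`. -/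
def HausLim {n : ℕ} (Ξ C : Set (QVec' n)) : Prop :=
  Filter.Tendsto (fun a : ℝ => EMetric.hausdorffEdist ((a • ·) '' Qr Ξ) (Qr C))
    (nhdsWithin 0 (Set.Ioi 0)) (nhds 0)

/-- The canonical limit `lim_{a→0⁺} a·Ξ` of the rescalings of `Ξ`: the set of rational
points whose distance to `a·Ξ` tends to `0` as `a → 0⁺`. -/
def limCell {n : ℕ} (Ξ : Set (QVec' n)) : Set (QVec' n) :=
  {x | Filter.Tendsto (fun a : ℝ => EMetric.infEdist (qr' x) ((a • ·) '' Qr Ξ))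
    (nhdsWithin 0 (Set.Ioi 0)) (nhds 0)}

/-- Appending a last coordinate: `(x, c) ∈ ℚ^{n+1}`. -/
def liftQ {n : ℕ} (x : QVec' n) (c : ℚ) : QVec' (n+1) := Fin.snoc x c

/-- The cone `C(Ξ) ⊆ ℚ^n × ℚ`: the closure (taken in `ℝ^{n+1}` and intersected with
`ℚ^{n+1}`) of `{a·(x,1) : a ∈ ℚ_{≥0}, x ∈ Ξ}`. -/
def coneOver {n : ℕ} (Ξ : Set (QVec' n)) : Set (QVec' (n+1)) :=
  {y | qr' y ∈ closure {z : RVec' (n+1) |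
        ∃ a : ℚ, 0 ≤ a ∧ ∃ x ∈ Ξ, z = (a : ℝ) • qr' (liftQ x 1)}}

/-- The slice `σ ∩ (ℚ^n × {0})`, identified with a subset of `ℚ^n`. -/
def slice0 {n : ℕ} (σ : Set (QVec' (n+1))) : Set (QVec' n) :=
  {x | liftQ x 0 ∈ σ}

/-- The dimension of a subset of `ℚ^n`: the rank of the linear space spanned by
the differences of its points. -/
def polyDim {n : ℕ} (Ξ : Set (QVec' n)) : ℕ := Module.finrank ℚ (vectorSpan ℚ Ξ)

section Generators

variable {V : Type*} [AddCommGroup V] [Module ℚ V]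

/-- Membership in the cone generated by a finite set, in terms of nonnegative coefficients. -/
theorem mem_hull_finset_iff {G : Finset V} {x : V} :
    x ∈ PointedCone.hull ℚ (G : Set V) ↔
      ∃ w : V → ℚ, (∀ g ∈ G, 0 ≤ w g) ∧ ∑ g ∈ G, w g • g = x := by
  constructor
  · intro hx
    obtain ⟨w, -, hw⟩ := Submodule.mem_span_finset.1 hx
    exact ⟨fun g => (w g : ℚ), fun g _ => (w g).2, hw⟩
  · rintro ⟨w, hw, rfl⟩
    exact sum_mem fun g hg =>
      PointedCone.smul_mem _ (hw g hg) (PointedCone.subset_hull hg)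

/-- A finite-dimensional space is finitely generated as a cone. -/
theorem exists_finset_hull_eq_top [Module.Finite ℚ V] :
    ∃ G : Finset V, PointedCone.hull ℚ (G : Set V) = ⊤ := by
  classical
  obtain ⟨S, hS⟩ := Module.Finite.fg_top (R := ℚ) (M := V)
  refine ⟨S ∪ S.image (fun x => -x), ?_⟩
  rw [eq_top_iff]
  intro x _
  have hx : x ∈ Submodule.span ℚ (S : Set V) := hS ▸ Submodule.mem_top
  obtain ⟨w, -, rfl⟩ := Submodule.mem_span_finset.1 hx
  refine sum_mem fun g hg => ?_
  rcases le_total 0 (w g) with h | h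
  · exact PointedCone.smul_mem _ h (PointedCone.subset_hull (by simp [Finset.mem_coe.1 hg]))
  · rw [← neg_smul_neg]
    exact PointedCone.smul_mem _ (by linarith)
      (PointedCone.subset_hull (by simp [Finset.mem_coe.1 hg]))

/-- Cutting a finitely generated cone with a half-space gives a finitely generated cone. -/
theorem exists_finset_hull_inter_halfSpace (G : Finset V) (f : V →ₗ[ℚ] ℚ) :
    ∃ G' : Finset V, ∀ x, x ∈ PointedCone.hull ℚ (G' : Set V) ↔
      x ∈ PointedCone.hull ℚ (G : Set V) ∧ 0 ≤ f x := by
  classical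
  let A := G.filter fun g => 0 ≤ f g
  let B := G.filter fun g => ¬ 0 ≤ f g
  let E := (A ×ˢ B).image fun p => f p.1 • p.2 - f p.2 • p.1
  have hA : ∀ g ∈ A, g ∈ G ∧ 0 ≤ f g := fun g hg => by simpa [A] using hg
  have hB : ∀ g ∈ B, g ∈ G ∧ f g < 0 := fun g hg => by simpa [B] using hg
  refine ⟨A ∪ E, fun x => ⟨fun hx => ?_, ?_⟩⟩
  · have hle : PointedCone.hull ℚ ((A ∪ E : Finset V) : Set V) ≤
        PointedCone.hull ℚ (G : Set V) ⊓ (PointedCone.positive ℚ ℚ).comap f := by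
      refine Submodule.span_le.2 fun g hg => ?_
      rw [Finset.mem_coe, Finset.mem_union] at hg
      rcases hg with hg | hg
      · exact ⟨PointedCone.subset_hull (hA g hg).1, (hA g hg).2⟩
      · obtain ⟨⟨p, q⟩, hpq, rfl⟩ := Finset.mem_image.1 hg
        obtain ⟨hp, hq⟩ := Finset.mem_product.1 hpq
        refine ⟨?_, ?_⟩
        · rw [sub_eq_add_neg, ← neg_smul]
          exact add_mem
            (PointedCone.smul_mem _ (hA p hp).2 (PointedCone.subset_hull (hB q hq).1))
            (PointedCone.smul_mem _ (by linarith [(hB q hq).2])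
              (PointedCone.subset_hull (hA p hp).1))
        · change 0 ≤ f (f p • q - f q • p)
          simp only [map_sub, map_smul, smul_eq_mul]
          linarith [mul_comm (f p) (f q)]
    exact hle hx
  · rintro ⟨hx, hfx⟩
    obtain ⟨w, hw, rfl⟩ := mem_hull_finset_iff.1 hx
    set a := ∑ g ∈ A, w g * f g with ha
    set b := ∑ g ∈ B, w g * -f g with hb
    have hsplit : ∑ g ∈ G, w g • g = ∑ g ∈ A, w g • g + ∑ g ∈ B, w g • g :=
      (Finset.sum_filter_add_sum_filter_not _ _ _).symm
    have hba : b ≤ a := by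
      rw [hsplit, map_add, map_sum, map_sum] at hfx
      simp only [map_smul, smul_eq_mul] at hfx
      simp only [hb, mul_neg, Finset.sum_neg_distrib]
      linarith
    have hb0 : ∀ g ∈ B, 0 ≤ w g * -f g := fun g hg =>
      mul_nonneg (hw g (hB g hg).1) (by linarith [(hB g hg).2])
    have hAmem : ∀ g ∈ A, w g • g ∈ PointedCone.hull ℚ ((A ∪ E : Finset V) : Set V) :=
      fun g hg => PointedCone.smul_mem _ (hw g (hA g hg).1)
        (PointedCone.subset_hull (by simp [hg]))
    rw [hsplit]
    rcases (Finset.sum_nonneg hb0).eq_or_lt with h0 | hpos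
    · have hz : ∑ g ∈ B, w g • g = 0 := by
        refine Finset.sum_eq_zero fun g hg => ?_
        have := (Finset.sum_eq_zero_iff_of_nonneg hb0).1 h0.symm g hg
        rcases mul_eq_zero.1 this with h | h
        · rw [h, zero_smul]
        · linarith [(hB g hg).2]
      rw [hz, add_zero]
      exact sum_mem hAmem
    · have hapos : 0 < a := hpos.trans_le hba
      have key : ∑ g ∈ A, w g • g + ∑ g ∈ B, w g • g =
          ∑ p ∈ A, (1 - b / a) • (w p • p) +
            ∑ p ∈ A, ∑ q ∈ B, (w p * w q / a) • (f p • q - f q • p) := by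
        have h1 : ∑ p ∈ A, ∑ q ∈ B, (w p * w q / a) • (f p • q - f q • p) =
            ∑ g ∈ B, w g • g + (b / a) • ∑ g ∈ A, w g • g := by
          simp only [smul_sub, Finset.sum_sub_distrib, smul_smul]
          have e1 : ∑ p ∈ A, ∑ q ∈ B, (w p * w q / a * f p) • q = ∑ g ∈ B, w g • g := by
            rw [Finset.sum_comm]
            refine Finset.sum_congr rfl fun q _ => ?_
            rw [← Finset.sum_smul]
            congr 1
            have : ∀ p ∈ A, w p * w q / a * f p = (w p * f p) * (w q / a) := fun p _ => by ring
            rw [Finset.sum_congr rfl this, ← Finset.sum_mul, ← ha]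
            field_simp
          have e2 : ∑ p ∈ A, ∑ q ∈ B, (w p * w q / a * f q) • p =
              - ((b / a) • ∑ g ∈ A, w g • g) := by
            rw [Finset.smul_sum, ← Finset.sum_neg_distrib]
            refine Finset.sum_congr rfl fun p _ => ?_
            rw [← Finset.sum_smul, smul_smul, ← neg_smul]
            congr 1
            have : ∀ q ∈ B, w p * w q / a * f q = (w q * -f q) * (-(w p / a)) :=
              fun q _ => by ring
            rw [Finset.sum_congr rfl this, ← Finset.sum_mul, ← hb]
            ring
          rw [e1, e2, sub_neg_eq_add]
        rw [h1, ← Finset.smul_sum, sub_smul, one_smul]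
        abel
      rw [key]
      refine add_mem (sum_mem fun g hg => PointedCone.smul_mem _ ?_ (hAmem g hg))
        (sum_mem fun p hp => sum_mem fun q hq => PointedCone.smul_mem _ ?_
          (PointedCone.subset_hull ?_))
      · rw [sub_nonneg, div_le_one hapos]
        exact hba
      · exact div_nonneg (mul_nonneg (hw p (hA p hp).1) (hw q (hB q hq).1)) hapos.le
      · rw [Finset.mem_coe]
        exact Finset.mem_union_right _
          (Finset.mem_image.2 ⟨(p, q), Finset.mem_product.2 ⟨hp, hq⟩, rfl⟩)

/-- The Minkowski–Weyl theorem: a polyhedral cone is finitely generated. -/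
theorem exists_finset_mem_hull_iff [Module.Finite ℚ V] (s : Finset (V →ₗ[ℚ] ℚ)) :
    ∃ G : Finset V, ∀ x, x ∈ PointedCone.hull ℚ (G : Set V) ↔ ∀ f ∈ s, 0 ≤ f x := by
  classical
  induction s using Finset.induction_on with
  | empty =>
    obtain ⟨G, hG⟩ := exists_finset_hull_eq_top (V := V)
    exact ⟨G, fun x => by simp [hG]⟩
  | insert f s _ ih =>
    obtain ⟨G, hG⟩ := ih
    obtain ⟨G', hG'⟩ := exists_finset_hull_inter_halfSpace G f
    exact ⟨G', fun x => by rw [hG', hG, Finset.forall_mem_insert, and_comm]⟩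

end Generators

/-- Pigeonhole for a sequence of properties indexed by a finite family. -/
theorem exists_frequently_of_finite {α : Type*} {P : Set α} (hP : P.Finite) {q : ℕ → α → Prop}
    (h : ∀ k, ∃ B ∈ P, q k B) : ∃ B ∈ P, ∃ᶠ k in Filter.atTop, q k B := by
  by_contra! hc
  have : ∀ᶠ k in Filter.atTop, ∀ B ∈ P, ¬ q k B := by
    rw [Filter.eventually_all_finite hP]
    exact fun B hB => by simpa using hc B hB
  obtain ⟨k, hk⟩ := this.exists
  obtain ⟨B, hB, hq⟩ := h k
  exact hk B hB hq

theorem nonneg_of_frequently_le {a b c : ℚ}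
    (h : ∃ᶠ k : ℕ in Filter.atTop, c ≤ a + k * b) : 0 ≤ b := by
  by_contra! hb
  obtain ⟨N, hN⟩ := exists_nat_gt ((a - c) / -b)
  obtain ⟨k, hk, hle⟩ := Filter.frequently_atTop.1 h N
  rw [div_lt_iff₀ (by linarith)] at hN
  have : (N : ℚ) ≤ k := by exact_mod_cast hk
  nlinarith

/-- A nonempty set cut out by finitely many affine inequalities in `ℚ` and bounded above by `1`
has a greatest element. -/
theorem exists_isGreatest_affine (I : Finset (ℚ × ℚ)) {s₀ : ℚ}
    (h₀ : s₀ ∈ {s | ∀ p ∈ I, 0 ≤ p.1 + p.2 * s} ∩ Set.Iic 1) :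
    ∃ M, IsGreatest ({s | ∀ p ∈ I, 0 ≤ p.1 + p.2 * s} ∩ Set.Iic 1) M := by
  classical
  induction I using Finset.induction_on with
  | empty => exact ⟨1, by simp, fun x hx => hx.2⟩
  | insert p I _ ih =>
    obtain ⟨h₁, h₀'⟩ := h₀
    simp only [Set.mem_ofPred_eq, Finset.forall_mem_insert] at h₁
    obtain ⟨M, ⟨hM, hM1⟩, hMax⟩ := ih ⟨h₁.2, h₀'⟩
    have hs₀M : s₀ ≤ M := hMax ⟨h₁.2, h₀'⟩
    by_cases hp : 0 ≤ p.1 + p.2 * M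
    · refine ⟨M, ⟨?_, hM1⟩, fun x hx => hMax ⟨?_, hx.2⟩⟩
      · simpa only [Set.mem_ofPred_eq, Finset.forall_mem_insert] using ⟨hp, hM⟩
      · exact fun q hq => hx.1 q (Finset.mem_insert_of_mem hq)
    · push Not at hp
      have hneg : p.2 < 0 := by
        by_contra! h
        nlinarith [h₁.1]
      set N := p.1 / -p.2 with hN
      have hNeq : p.2 * N = -p.1 := by
        have := hneg.ne
        rw [hN]
        field_simp
      have hNM : N ≤ M := by
        by_contra! h
        nlinarith
      have hsN : s₀ ≤ N := by
        by_contra! h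
        nlinarith [h₁.1]
      refine ⟨N, ⟨?_, hNM.trans hM1⟩, fun x hx => ?_⟩
      · simp only [Set.mem_ofPred_eq, Finset.forall_mem_insert]
        refine ⟨by linarith, fun q hq => ?_⟩
        rcases le_total 0 q.2 with h | h
        · nlinarith [h₁.2 q hq]
        · nlinarith [hM q hq]
      · have := hx.1 p (Finset.mem_insert_self _ _)
        by_contra! h
        nlinarith

section Recession

variable {n : ℕ}

/-- The linear functional on `ℚ^n` given by an integer covector. -/
def pairing (m : Fin n → ℤ) : QVec' n →ₗ[ℚ] ℚ := ∑ i, (m i : ℚ) • LinearMap.proj i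

theorem pairing_apply (m : Fin n → ℤ) (x : QVec' n) : pairing m x = ∑ i, (m i : ℚ) * x i := by
  simp [pairing]

theorem pairing_sum {ι : Type*} (t : Finset ι) (m : ι → Fin n → ℤ) (x : QVec' n) :
    pairing (∑ j ∈ t, m j) x = ∑ j ∈ t, pairing (m j) x := by
  simp only [pairing_apply, Finset.sum_apply, Int.cast_sum, Finset.sum_mul]
  exact Finset.sum_comm

theorem pairing_neg (m : Fin n → ℤ) (x : QVec' n) : pairing (-m) x = -pairing m x := by
  simp [pairing_apply]

theorem mem_solSet {s : Finset ((Fin n → ℤ) × ℚ)} {x : QVec' n} :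
    x ∈ solSet s ↔ ∀ c ∈ s, c.2 ≤ pairing c.1 x := by
  simp only [solSet, pairing_apply]
  rfl

/-- The recession cone of a subset of `ℚ^n`. -/
def recCone (Ξ : Set (QVec' n)) : Set (QVec' n) :=
  {r | ∀ x ∈ Ξ, ∀ t : ℚ, 0 ≤ t → x + t • r ∈ Ξ}

theorem zero_mem_recCone (Ξ : Set (QVec' n)) : (0 : QVec' n) ∈ recCone Ξ :=
  fun x hx t _ => by simpa using hx

theorem smul_mem_recCone {Ξ : Set (QVec' n)} {r : QVec' n} (hr : r ∈ recCone Ξ) {a : ℚ}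
    (ha : 0 ≤ a) : a • r ∈ recCone Ξ :=
  fun x hx t ht => by simpa [smul_smul] using hr x hx (t * a) (mul_nonneg ht ha)

theorem nonneg_of_le_on_ray {m : Fin n → ℤ} {c : ℚ} {x r : QVec' n}
    (h : ∃ᶠ k : ℕ in Filter.atTop, c ≤ pairing m (x + (k : ℚ) • r)) : 0 ≤ pairing m r :=
  nonneg_of_frequently_le (a := pairing m x) (c := c) (by simpa using h)

theorem mem_recCone_of_frequently {s : Finset ((Fin n → ℤ) × ℚ)} {x r : QVec' n}
    (h : ∃ᶠ k : ℕ in Filter.atTop, x + (k : ℚ) • r ∈ solSet s) :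
    ∀ c ∈ s, 0 ≤ pairing c.1 r :=
  fun c hc => nonneg_of_le_on_ray (c := c.2) (h.mono fun _ hk => mem_solSet.1 hk c hc)

theorem mem_recCone_solSet {s : Finset ((Fin n → ℤ) × ℚ)} (hne : (solSet s).Nonempty)
    {r : QVec' n} : r ∈ recCone (solSet s) ↔ ∀ c ∈ s, 0 ≤ pairing c.1 r := by
  constructor
  · intro hr
    obtain ⟨x, hx⟩ := hne
    exact mem_recCone_of_frequently (x := x)
      (Filter.Eventually.of_forall fun k : ℕ => hr x hx k k.cast_nonneg).frequently
  · intro hr x hx t ht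
    rw [mem_solSet] at hx ⊢
    intro c hc
    rw [map_add, map_smul, smul_eq_mul]
    linarith [hx c hc, mul_nonneg ht (hr c hc)]

theorem mem_recCone_of_frequently_mem {Ξ : Set (QVec' n)} (hΞ : IsRatPolyhedron Ξ)
    {x r : QVec' n} (h : ∃ᶠ k : ℕ in Filter.atTop, x + (k : ℚ) • r ∈ Ξ) : r ∈ recCone Ξ := by
  obtain ⟨s, rfl⟩ := hΞ
  obtain ⟨k, hk⟩ := h.exists
  exact (mem_recCone_solSet ⟨_, hk⟩).2 (mem_recCone_of_frequently h)

theorem mem_recCone_inter {A B : Set (QVec' n)} {r : QVec' n} (hA : r ∈ recCone A)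
    (hB : r ∈ recCone B) : r ∈ recCone (A ∩ B) :=
  fun x hx t ht => ⟨hA x hx.1 t ht, hB x hx.2 t ht⟩

/-- A face is the locus where a single valid inequality is tight. -/
theorem isFaceOf_iff {P F : Set (QVec' n)} (hP : IsRatPolyhedron P) :
    IsFaceOf P F ↔ F.Nonempty ∧ ∃ (m : Fin n → ℤ) (c : ℚ), (∀ x ∈ P, c ≤ pairing m x) ∧
      F = {x | x ∈ P ∧ pairing m x = c} := by
  classical
  constructor
  · rintro ⟨hne, s, hs, t, ht, hF⟩
    refine ⟨hne, ∑ c ∈ t, c.1, ∑ c ∈ t, c.2, fun x hx => ?_, ?_⟩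
    · rw [pairing_sum]
      rw [hs, mem_solSet] at hx
      exact Finset.sum_le_sum fun c hc => hx c (ht hc)
    · rw [hF]
      ext x
      simp only [← pairing_apply, Set.mem_ofPred_eq, and_congr_right_iff, pairing_sum]
      intro hx
      rw [hs, mem_solSet] at hx
      rw [eq_comm (a := ∑ c ∈ t, pairing c.1 x),
        Finset.sum_eq_sum_iff_of_le fun c hc => hx c (ht hc)]
      simp only [eq_comm]
  · rintro ⟨hne, m, c, hle, hF⟩
    obtain ⟨s, rfl⟩ := hP
    refine ⟨hne, insert (m, c) s, ?_, {(m, c)}, by simp, ?_⟩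
    · ext x
      simp only [mem_solSet, Finset.forall_mem_insert]
      exact ⟨fun h => ⟨hle x (mem_solSet.2 h), h⟩, fun h => h.2⟩
    · simp [hF, pairing_apply]

theorem isRatPolyhedron_inter_hyperplane {P : Set (QVec' n)} (hP : IsRatPolyhedron P)
    (m : Fin n → ℤ) (c : ℚ) : IsRatPolyhedron {x | x ∈ P ∧ pairing m x = c} := by
  classical
  obtain ⟨s, rfl⟩ := hP
  refine ⟨insert (m, c) (insert (-m, -c) s), ?_⟩
  ext x
  simp only [mem_solSet, Finset.forall_mem_insert, pairing_neg, Set.mem_ofPred_eq]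
  constructor
  · rintro ⟨h, rfl⟩
    exact ⟨le_rfl, le_rfl, h⟩
  · rintro ⟨h1, h2, h⟩
    exact ⟨h, by linarith⟩

theorem recCone_inter_hyperplane {P : Set (QVec' n)} (hP : IsRatPolyhedron P)
    {m : Fin n → ℤ} {c : ℚ} (hne : {x | x ∈ P ∧ pairing m x = c}.Nonempty) :
    recCone {x | x ∈ P ∧ pairing m x = c} = {r | r ∈ recCone P ∧ pairing m r = 0} := by
  obtain ⟨x, hx, hxc⟩ := hne
  ext r
  constructor
  · intro hr
    have hray := fun t ht => hr x ⟨hx, hxc⟩ t ht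
    refine ⟨mem_recCone_of_frequently_mem hP
      (Filter.Eventually.of_forall fun k : ℕ => (hray k k.cast_nonneg).1).frequently, ?_⟩
    have := (hray 1 zero_le_one).2
    rw [one_smul, map_add, hxc] at this
    linarith
  · rintro ⟨hr, hr0⟩ y ⟨hy, hyc⟩ t ht
    exact ⟨hr y hy t ht, by rw [map_add, map_smul, hr0, smul_zero, add_zero, hyc]⟩

theorem isRatCone_recCone {P : Set (QVec' n)} (hP : IsRatPolyhedron P) (hne : P.Nonempty) :
    IsRatCone (recCone P) := by
  classical
  obtain ⟨s, rfl⟩ := hP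
  refine ⟨s.image Prod.fst, ?_⟩
  ext r
  simp only [mem_recCone_solSet hne, ← pairing_apply, Set.mem_ofPred_eq, Finset.forall_mem_image]

theorem IsRatCone.isRatPolyhedron {C : Set (QVec' n)} (hC : IsRatCone C) :
    IsRatPolyhedron C := by
  classical
  obtain ⟨s, rfl⟩ := hC
  refine ⟨s.image fun m => (m, 0), ?_⟩
  ext r
  simp only [mem_solSet, Finset.forall_mem_image, pairing_apply, Set.mem_ofPred_eq]

theorem isRatPolyhedron_recCone {P : Set (QVec' n)} (hP : IsRatPolyhedron P)
    (hne : P.Nonempty) : IsRatPolyhedron (recCone P) :=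
  (isRatCone_recCone hP hne).isRatPolyhedron

/-- The recession cone of a face is a face of the recession cone. -/
theorem IsFaceOf.exists_recCone {P F : Set (QVec' n)} (hP : IsRatPolyhedron P)
    (hF : IsFaceOf P F) : ∃ m : Fin n → ℤ, (∀ r ∈ recCone P, 0 ≤ pairing m r) ∧
      recCone F = {r | r ∈ recCone P ∧ pairing m r = 0} := by
  obtain ⟨hne, m, c, hle, rfl⟩ := (isFaceOf_iff hP).1 hF
  refine ⟨m, fun r hr => ?_, recCone_inter_hyperplane hP hne⟩
  obtain ⟨x, hx, -⟩ := hne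
  exact nonneg_of_le_on_ray (c := c) (x := x)
    (Filter.Eventually.of_forall fun k : ℕ => hle _ (hr x hx k k.cast_nonneg)).frequently

theorem IsFaceOf.recCone {P F : Set (QVec' n)} (hP : IsRatPolyhedron P) (hF : IsFaceOf P F) :
    IsFaceOf (recCone P) (recCone F) := by
  have hne : P.Nonempty := by
    obtain ⟨⟨x, hx⟩, m, c, -, rfl⟩ := (isFaceOf_iff hP).1 hF
    exact ⟨x, hx.1⟩
  obtain ⟨m, hm, h⟩ := hF.exists_recCone hP
  exact (isFaceOf_iff (isRatPolyhedron_recCone hP hne)).2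
    ⟨⟨0, zero_mem_recCone F⟩, m, 0, hm, h⟩

theorem recCone_singleton (x : QVec' n) : recCone {x} = {0} := by
  ext r
  constructor
  · intro hr
    simpa using hr x rfl 1 zero_le_one
  · rintro rfl
    exact zero_mem_recCone _

theorem IsStronglyConvexPoly.nonempty {P : Set (QVec' n)} (hP : IsStronglyConvexPoly P) :
    P.Nonempty := by
  obtain ⟨hrat, x, hx⟩ := hP
  obtain ⟨⟨y, hy⟩, m, c, -, h⟩ := (isFaceOf_iff hrat).1 hx
  rw [h] at hy
  exact ⟨y, hy.1⟩

theorem isStronglyConvexCone_recCone {P : Set (QVec' n)} (hP : IsStronglyConvexPoly P) :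
    IsStronglyConvexCone (recCone P) := by
  obtain ⟨hrat, x, hx⟩ := hP
  exact ⟨isRatCone_recCone hrat (IsStronglyConvexPoly.nonempty ⟨hrat, x, hx⟩),
    recCone_singleton x ▸ hx.recCone hrat⟩

/-- A rational polyhedron is, up to its recession cone, the convex hull of a finite set. -/
theorem exists_finset_convexHull_add_recCone {P : Set (QVec' n)} (hP : IsRatPolyhedron P)
    (hne : P.Nonempty) : ∃ K : Finset (QVec' n), (K : Set (QVec' n)) ⊆ P ∧
      ∀ x ∈ P, ∃ y ∈ convexHull ℚ (K : Set (QVec' n)), x - y ∈ recCone P := by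
  classical
  obtain ⟨s, rfl⟩ := hP
  obtain ⟨G, hG⟩ := exists_finset_mem_hull_iff (V := QVec' n × ℚ)
    (insert (LinearMap.snd ℚ (QVec' n) ℚ) (s.image fun c =>
      (pairing c.1).comp (LinearMap.fst ℚ (QVec' n) ℚ) - c.2 • LinearMap.snd ℚ (QVec' n) ℚ))
  have hG' : ∀ z : QVec' n × ℚ, z ∈ PointedCone.hull ℚ (G : Set (QVec' n × ℚ)) ↔
      0 ≤ z.2 ∧ ∀ c ∈ s, c.2 * z.2 ≤ pairing c.1 z.1 := fun z => by
    rw [hG, Finset.forall_mem_insert, Finset.forall_mem_image]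
    simp
  have hmem : ∀ g ∈ G, 0 ≤ g.2 ∧ ∀ c ∈ s, c.2 * g.2 ≤ pairing c.1 g.1 := fun g hg =>
    (hG' g).1 (PointedCone.subset_hull hg)
  let A := G.filter fun g => 0 < g.2
  have hA : ∀ g ∈ A, g ∈ G ∧ 0 < g.2 := fun g hg => by simpa [A] using hg
  refine ⟨A.image fun g => g.2⁻¹ • g.1, ?_, fun x hx => ?_⟩
  · intro y hy
    obtain ⟨g, hg, rfl⟩ := Finset.mem_image.1 hy
    obtain ⟨hgG, hpos⟩ := hA g hg
    rw [mem_solSet]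
    intro c hc
    rw [map_smul, smul_eq_mul, le_inv_mul_iff₀ hpos, mul_comm]
    exact (hmem g hgG).2 c hc
  · have hx1 : (x, (1 : ℚ)) ∈ PointedCone.hull ℚ (G : Set (QVec' n × ℚ)) :=
      (hG' _).2 ⟨zero_le_one, fun c hc => by simpa using mem_solSet.1 hx c hc⟩
    obtain ⟨w, hw, hsum⟩ := mem_hull_finset_iff.1 hx1
    have h1 : ∑ g ∈ G, w g • g.1 = x := by
      simpa [Prod.fst_sum] using congrArg Prod.fst hsum
    have h2 : ∑ g ∈ G, w g * g.2 = 1 := by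
      simpa [Prod.snd_sum] using congrArg Prod.snd hsum
    refine ⟨∑ g ∈ A, (w g * g.2) • (g.2⁻¹ • g.1), ?_, ?_⟩
    · refine (convex_convexHull ℚ _).sum_mem
        (fun g hg => mul_nonneg (hw g (hA g hg).1) (hA g hg).2.le) ?_
        (fun g hg => subset_convexHull ℚ _ (Finset.mem_image_of_mem _ hg))
      rw [← h2]
      refine Finset.sum_subset (Finset.filter_subset _ _) fun g hg hgA => ?_
      have : g.2 = 0 := le_antisymm (by simpa [A, hg] using hgA) (hmem g hg).1
      rw [this, mul_zero]
    · have hdiff : x - ∑ g ∈ A, (w g * g.2) • (g.2⁻¹ • g.1) =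
          ∑ g ∈ G.filter (fun g => ¬ 0 < g.2), w g • g.1 := by
        rw [← h1, ← Finset.sum_filter_add_sum_filter_not G (fun g => 0 < g.2),
          sub_eq_iff_eq_add', add_left_inj]
        refine Finset.sum_congr rfl fun g hg => ?_
        rw [smul_smul, mul_assoc, mul_inv_cancel₀ (hA g hg).2.ne', mul_one]
      rw [hdiff, mem_recCone_solSet hne]
      intro c hc
      rw [map_sum]
      refine Finset.sum_nonneg fun g hg => ?_
      obtain ⟨hgG, hg0⟩ := Finset.mem_filter.1 hg
      have h0 : g.2 = 0 := le_antisymm (not_lt.1 hg0) (hmem g hgG).1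
      have := (hmem g hgG).2 c hc
      rw [h0, mul_zero] at this
      rw [map_smul]
      exact mul_nonneg (hw g hgG) this

/-- Every face of the recession cone is the recession cone of a face. -/
theorem exists_face_recCone_eq {P F : Set (QVec' n)} (hP : IsRatPolyhedron P)
    (hne : P.Nonempty) (hF : IsFaceOf (recCone P) F) : ∃ G, IsFaceOf P G ∧ recCone G = F := by
  obtain ⟨⟨r, hr⟩, m, c, hle, rfl⟩ := (isFaceOf_iff (isRatPolyhedron_recCone hP hne)).1 hF
  have hc : c = 0 := by
    have h0 := hle 0 (zero_mem_recCone P)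
    have h2 := hle _ (smul_mem_recCone hr.1 (a := 2) zero_le_two)
    rw [map_zero] at h0
    rw [map_smul, hr.2, smul_eq_mul] at h2
    linarith
  subst hc
  obtain ⟨K, hKP, hK⟩ := exists_finset_convexHull_add_recCone hP hne
  have hKne : K.Nonempty := by
    obtain ⟨x, hx⟩ := hne
    obtain ⟨y, hy, -⟩ := hK x hx
    exact convexHull_nonempty_iff.1 ⟨y, hy⟩
  obtain ⟨k, hk, hmin⟩ := K.exists_min_image (pairing m) hKne
  have hge : ∀ x ∈ P, pairing m k ≤ pairing m x := by
    intro x hx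
    obtain ⟨y, hy, hxy⟩ := hK x hx
    have hy' : pairing m k ≤ pairing m y :=
      convexHull_min (t := {y | pairing m k ≤ pairing m y}) (fun z hz => hmin z hz)
        (convex_halfSpace_ge (pairing m).isLinear _) hy
    have := hle _ hxy
    rw [map_sub] at this
    linarith
  have hGne : {x | x ∈ P ∧ pairing m x = pairing m k}.Nonempty := ⟨k, hKP hk, rfl⟩
  exact ⟨_, (isFaceOf_iff hP).2 ⟨hGne, m, _, hge, rfl⟩, recCone_inter_hyperplane hP hGne⟩

end Recession

section MinFace

variable {n : ℕ}

/-- The smallest face of a cone `C` that contains `v`. -/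
def minFace (C : Set (QVec' n)) (v : QVec' n) : Set (QVec' n) :=
  {r | r ∈ C ∧ ∃ t : ℚ, t • v - r ∈ C}

theorem minFace_recCone_face {P F : Set (QVec' n)} (hP : IsRatPolyhedron P)
    (hF : IsFaceOf P F) {v : QVec' n} (hv : v ∈ recCone F) :
    minFace (recCone F) v = minFace (recCone P) v := by
  obtain ⟨m, hm, h⟩ := hF.exists_recCone hP
  rw [h] at hv ⊢
  ext r
  constructor
  · rintro ⟨hr, t, ht⟩
    exact ⟨hr.1, t, ht.1⟩
  · rintro ⟨hr, t, ht⟩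
    have h1 := hm r hr
    have h2 := hm _ ht
    rw [map_sub, map_smul, hv.2, smul_zero] at h2
    have h0 : pairing m r = 0 := by linarith
    exact ⟨⟨hr, h0⟩, t, ht, by rw [map_sub, map_smul, hv.2, h0, smul_zero, sub_zero]⟩

theorem isFaceOf_minFace {P : Set (QVec' n)} (hP : IsRatPolyhedron P) (hne : P.Nonempty)
    {v : QVec' n} (hv : v ∈ recCone P) : IsFaceOf (recCone P) (minFace (recCone P) v) := by
  classical
  refine (isFaceOf_iff (isRatPolyhedron_recCone hP hne)).2
    ⟨⟨0, zero_mem_recCone P, 0, by simpa using zero_mem_recCone P⟩, ?_⟩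
  obtain ⟨s, rfl⟩ := hP
  have hiff := fun r => mem_recCone_solSet hne (r := r)
  refine ⟨∑ c ∈ s.filter fun c => pairing c.1 v = 0, c.1, 0, fun r hr => ?_, ?_⟩
  · rw [pairing_sum]
    exact Finset.sum_nonneg fun c hc => (hiff r).1 hr c (Finset.mem_filter.1 hc).1
  · ext r
    refine and_congr_right fun hr => ?_
    rw [hiff] at hr hv
    rw [pairing_sum, Finset.sum_eq_zero_iff_of_nonneg
      fun c hc => hr c (Finset.mem_filter.1 hc).1]
    simp only [hiff, map_sub, map_smul, smul_eq_mul, sub_nonneg, Finset.mem_filter, and_imp]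
    constructor
    · rintro ⟨t, ht⟩ c hc hc0
      have := ht c hc
      rw [hc0, mul_zero] at this
      exact le_antisymm this (hr c hc)
    · intro h
      have : ∀ᶠ t : ℚ in Filter.atTop, ∀ c ∈ s, pairing c.1 r ≤ t * pairing c.1 v := by
        rw [Filter.eventually_all_finset]
        intro c hc
        rcases (hv c hc).eq_or_lt with h0 | h0
        · simp [h c hc h0.symm, ← h0]
        · filter_upwards [Filter.eventually_ge_atTop (pairing c.1 r / pairing c.1 v)] with t ht
          exact (div_le_iff₀ h0).1 ht
      exact this.exists

end MinFace

section Decomposition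

variable {n : ℕ}

variable {P : Set (Set (QVec' n))}

/-- Two cells that meet have the same minimal recession face through a common direction. -/
theorem IsPolyDecomp.minFace_eq_of_inter (hP : IsPolyDecomp P) {A B : Set (QVec' n)}
    (hA : A ∈ P) (hB : B ∈ P) (hAB : (A ∩ B).Nonempty) {v : QVec' n} (hvA : v ∈ recCone A)
    (hvB : v ∈ recCone B) : minFace (recCone A) v = minFace (recCone B) v := by
  obtain ⟨-, hsc, -, -, hint⟩ := hP
  obtain ⟨hfA, hfB⟩ := hint A hA B hB hAB
  have hv := mem_recCone_inter hvA hvB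
  rw [← minFace_recCone_face (hsc A hA).1 hfA hv, minFace_recCone_face (hsc B hB).1 hfB hv]

theorem IsPolyDecomp.exists_ray (hP : IsPolyDecomp P) (x v : QVec' n) :
    ∃ B ∈ P, v ∈ recCone B ∧ ∃ t : ℚ, 0 ≤ t ∧ x + t • v ∈ B := by
  obtain ⟨hfin, hsc, hcov, -, -⟩ := hP
  obtain ⟨B, hB, hfreq⟩ := exists_frequently_of_finite hfin
    (q := fun k B => x + (k : ℚ) • v ∈ B)
    fun k => Set.mem_sUnion.1 (hcov ▸ Set.mem_univ (x + (k : ℚ) • v))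
  obtain ⟨k, hk⟩ := hfreq.exists
  exact ⟨B, hB, mem_recCone_of_frequently_mem (hsc B hB).1 hfreq, k, k.cast_nonneg, hk⟩

/-- The shadow of a polyhedron on a line, along a recession direction, is cut out by finitely many
affine inequalities. -/
theorem exists_affine_shadow {A : Set (QVec' n)} (hA : IsRatPolyhedron A) (hne : A.Nonempty)
    {v : QVec' n} (hv : v ∈ recCone A) (x d : QVec' n) : ∃ I : Finset (ℚ × ℚ),
      {s : ℚ | ∃ t : ℚ, 0 ≤ t ∧ (x + s • d) + t • v ∈ A} =
        {s | ∀ p ∈ I, 0 ≤ p.1 + p.2 * s} := by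
  classical
  obtain ⟨σ, rfl⟩ := hA
  rw [mem_recCone_solSet hne] at hv
  refine ⟨(σ.filter fun c => pairing c.1 v = 0).image
    fun c => (pairing c.1 x - c.2, pairing c.1 d), ?_⟩
  ext s
  simp only [mem_solSet, Set.mem_ofPred_eq, Finset.forall_mem_image, Finset.mem_filter, and_imp,
    map_add, map_smul, smul_eq_mul]
  constructor
  · rintro ⟨t, -, ht⟩ c hc hc0
    have := ht c hc
    rw [hc0] at this
    linarith
  · intro h
    have : ∀ᶠ t : ℚ in Filter.atTop,
        ∀ c ∈ σ, c.2 ≤ pairing c.1 x + s * pairing c.1 d + t * pairing c.1 v := by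
      rw [Filter.eventually_all_finset]
      intro c hc
      rcases (hv c hc).eq_or_lt with h0 | h0
      · refine Filter.Eventually.of_forall fun t => ?_
        have := h hc h0.symm
        rw [← h0]
        linarith
      · filter_upwards [Filter.eventually_ge_atTop
          ((c.2 - (pairing c.1 x + s * pairing c.1 d)) / pairing c.1 v)] with t ht
        linarith [(div_le_iff₀ h0).1 ht]
    exact ((Filter.eventually_ge_atTop 0).and this).exists

theorem isClosed_affine_inequalities (I : Finset (ℚ × ℚ)) :
    IsClosed {s : ℚ | ∀ p ∈ I, 0 ≤ p.1 + p.2 * s} := by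
  simp only [Set.ofPred_forall]
  exact isClosed_biInter fun p _ => isClosed_le continuous_const (by fun_prop)

/-- In a polyhedral decomposition, the minimal face through `v` of a recession cone containing `v`
does not depend on the cell. -/
theorem IsPolyDecomp.minFace_eq (hP : IsPolyDecomp P) {A B : Set (QVec' n)}
    (hA : A ∈ P) (hB : B ∈ P) {v : QVec' n} (hvA : v ∈ recCone A) (hvB : v ∈ recCone B) :
    minFace (recCone A) v = minFace (recCone B) v := by
  obtain ⟨xA, hxA⟩ := (hP.2.1 A hA).nonempty
  obtain ⟨xB, hxB⟩ := (hP.2.1 B hB).nonempty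
  let S : Set (QVec' n) → Set ℚ := fun Ξ =>
    {s | ∃ t : ℚ, 0 ≤ t ∧ (xA + s • (xB - xA)) + t • v ∈ Ξ}
  have hS : ∀ Ξ ∈ P, v ∈ recCone Ξ → ∃ I : Finset (ℚ × ℚ),
      S Ξ = {s | ∀ p ∈ I, 0 ≤ p.1 + p.2 * s} := fun Ξ hΞ hv =>
    exists_affine_shadow (hP.2.1 Ξ hΞ).1 (hP.2.1 Ξ hΞ).nonempty hv _ _
  have hmeet : ∀ Ξ ∈ P, ∀ Ξ' ∈ P, v ∈ recCone Ξ → v ∈ recCone Ξ' → (S Ξ ∩ S Ξ').Nonempty →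
      minFace (recCone Ξ) v = minFace (recCone Ξ') v := by
    rintro Ξ hΞ Ξ' hΞ' hv hv' ⟨s, ⟨t, -, hmem⟩, ⟨t', -, hmem'⟩⟩
    refine hP.minFace_eq_of_inter hΞ hΞ'
      ⟨(xA + s • (xB - xA)) + max t t' • v, ?_, ?_⟩ hv hv'
    · have := hv _ hmem (max t t' - t) (sub_nonneg.2 (le_max_left _ _))
      rwa [add_assoc, ← add_smul, add_sub_cancel] at this
    · have := hv' _ hmem' (max t t' - t') (sub_nonneg.2 (le_max_right _ _))
      rwa [add_assoc, ← add_smul, add_sub_cancel] at this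
  let T : Set (Set (QVec' n)) := {Ξ | Ξ ∈ P ∧ v ∈ recCone Ξ ∧
    minFace (recCone Ξ) v = minFace (recCone A) v ∧ (S Ξ ∩ Set.Iic 1).Nonempty}
  have hTfin : T.Finite := hP.1.subset fun Ξ h => h.1
  have hAT : A ∈ T := ⟨hA, hvA, rfl, 0, ⟨0, le_rfl, by simpa using hxA⟩, Set.mem_Iic.2 zero_le_one⟩
  have hgreat : ∀ Ξ, ∃ M, Ξ ∈ T → IsGreatest (S Ξ ∩ Set.Iic 1) M := by
    intro Ξ
    by_cases hΞ : Ξ ∈ T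
    · obtain ⟨hΞP, hv, -, s₀, hs₀⟩ := id hΞ
      obtain ⟨I, hI⟩ := hS Ξ hΞP hv
      rw [hI] at hs₀ ⊢
      obtain ⟨M, hM⟩ := exists_isGreatest_affine I hs₀
      exact ⟨M, fun _ => hM⟩
    · exact ⟨0, fun h => absurd h hΞ⟩
  choose M hM using hgreat
  obtain ⟨Ξ, hΞT, hmax⟩ := Set.exists_max_image T M hTfin ⟨A, hAT⟩
  obtain ⟨hΞP, hvΞ, hΞA, -⟩ := id hΞT
  obtain ⟨⟨hMS, hM1⟩, -⟩ := hM Ξ hΞT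
  rw [← hΞA]
  rcases (show M Ξ ≤ 1 from hM1).eq_or_lt with h1 | hlt
  · refine hmeet Ξ hΞP B hB hvΞ hvB ⟨1, h1 ▸ hMS, 0, le_rfl, ?_⟩
    simpa using hxB
  · exfalso
    let u : ℕ → ℚ := fun k => M Ξ + (1 - M Ξ) * (1 / ((k : ℚ) + 1))
    have hu : Filter.Tendsto u Filter.atTop (nhds (M Ξ)) := by
      have h := (tendsto_one_div_add_atTop_nhds_zero_nat (𝕜 := ℚ)).const_mul (1 - M Ξ)
      simpa [u] using h.const_add (M Ξ)
    obtain ⟨Ω, hΩ, hfreq⟩ := exists_frequently_of_finite hP.1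
      (q := fun k Ω => v ∈ recCone Ω ∧ u k ∈ S Ω)
      fun k => hP.exists_ray (xA + u k • (xB - xA)) v
    obtain ⟨k, hvΩ, hk⟩ := hfreq.exists
    obtain ⟨I, hI⟩ := hS Ω hΩ hvΩ
    have hcl : IsClosed (S Ω) := hI ▸ isClosed_affine_inequalities I
    have hlim : M Ξ ∈ S Ω :=
      hcl.mem_of_frequently_of_tendsto (hfreq.mono fun _ h => h.2) hu
    have hk0 : (0 : ℚ) < (k : ℚ) + 1 := by positivity
    have huk : M Ξ < u k := by
      have : 0 < (1 - M Ξ) * (1 / ((k : ℚ) + 1)) :=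
        mul_pos (by linarith) (by positivity)
      simp only [u]
      linarith
    have huk1 : u k ≤ 1 := by
      have hle : 1 / ((k : ℚ) + 1) ≤ 1 := by
        rw [div_le_one hk0]
        linarith [(k.cast_nonneg : (0 : ℚ) ≤ k)]
      have := mul_le_mul_of_nonneg_left hle (by linarith : 0 ≤ 1 - M Ξ)
      simp only [u]
      linarith
    have hΩT : Ω ∈ T :=
      ⟨hΩ, hvΩ, (hmeet Ω hΩ Ξ hΞP hvΩ hvΞ ⟨_, hlim, hMS⟩).trans hΞA, u k, hk, huk1⟩
    have := (hM Ω hΩT).2 ⟨hk, huk1⟩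
    linarith [hmax Ω hΩT]

/-- A point in the relative interior of the intersection of two recession cones. -/
theorem exists_relint_inter {A B : Set (QVec' n)} (hA : IsRatPolyhedron A) (hAne : A.Nonempty)
    (hB : IsRatPolyhedron B) (hBne : B.Nonempty) : ∃ v ∈ recCone A ∩ recCone B,
      ∀ r ∈ recCone A ∩ recCone B, ∃ t : ℚ, t • v - r ∈ recCone A ∩ recCone B := by
  classical
  obtain ⟨s, rfl⟩ := hA
  obtain ⟨s', rfl⟩ := hB
  obtain ⟨G, hG⟩ := exists_finset_mem_hull_iff ((s ∪ s').image fun c => pairing c.1)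
  have hiff : ∀ r, r ∈ recCone (solSet s) ∩ recCone (solSet s') ↔
      r ∈ PointedCone.hull ℚ (G : Set (QVec' n)) := by
    intro r
    rw [hG, Finset.forall_mem_image, Set.mem_inter_iff, mem_recCone_solSet hAne,
      mem_recCone_solSet hBne, Finset.forall_mem_union]
  simp only [hiff]
  refine ⟨∑ g ∈ G, g, sum_mem fun g hg => PointedCone.subset_hull hg, fun r hr => ?_⟩
  obtain ⟨w, hw, rfl⟩ := mem_hull_finset_iff.1 hr
  refine ⟨∑ g ∈ G, w g, ?_⟩
  rw [Finset.smul_sum, ← Finset.sum_sub_distrib]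
  refine sum_mem fun g hg => ?_
  rw [← sub_smul]
  exact PointedCone.smul_mem _ (sub_nonneg.2 (Finset.single_le_sum hw hg))
    (PointedCone.subset_hull hg)

theorem IsPolyDecomp.isFaceOf_inter_recCone (hP : IsPolyDecomp P) {A B : Set (QVec' n)}
    (hA : A ∈ P) (hB : B ∈ P) : IsFaceOf (recCone A) (recCone A ∩ recCone B) := by
  have hA' := hP.2.1 A hA
  have hB' := hP.2.1 B hB
  obtain ⟨v, hv, hrel⟩ := exists_relint_inter hA'.1 hA'.nonempty hB'.1 hB'.nonempty
  have heq := hP.minFace_eq hA hB hv.1 hv.2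
  have : recCone A ∩ recCone B = minFace (recCone A) v := by
    apply Set.Subset.antisymm
    · intro r hr
      obtain ⟨t, ht⟩ := hrel r hr
      exact ⟨hr.1, t, ht.1⟩
    · intro r hr
      exact ⟨hr.1, (heq ▸ hr).1⟩
  rw [this]
  exact isFaceOf_minFace hA'.1 hA'.nonempty hv.1

/-- The recession cones of a polyhedral decomposition form a complete fan. -/
theorem IsPolyDecomp.isCompleteFan_recCone (hP : IsPolyDecomp P) :
    IsCompleteFan (recCone '' P) := by
  refine ⟨⟨hP.1.image _, ?_, ?_, ?_⟩, ?_⟩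
  · rintro _ ⟨A, hA, rfl⟩
    exact isStronglyConvexCone_recCone (hP.2.1 A hA)
  · rintro _ ⟨A, hA, rfl⟩ F hF
    obtain ⟨G, hG, rfl⟩ :=
      exists_face_recCone_eq (hP.2.1 A hA).1 (hP.2.1 A hA).nonempty hF
    exact ⟨G, hP.2.2.2.1 A hA G hG, rfl⟩
  · rintro _ ⟨A, hA, rfl⟩ _ ⟨B, hB, rfl⟩ -
    exact ⟨hP.isFaceOf_inter_recCone hA hB,
      Set.inter_comm (recCone A) _ ▸ hP.isFaceOf_inter_recCone hB hA⟩
  · refine Set.eq_univ_of_forall fun v => ?_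
    obtain ⟨B, hB, hv, -⟩ := hP.exists_ray 0 v
    exact ⟨_, ⟨B, hB, rfl⟩, hv⟩

end Decomposition

section HausdorffLimit

variable {n : ℕ}

theorem qr'_add (x y : QVec' n) : qr' (x + y) = qr' x + qr' y := by
  ext i; simp [qr']

theorem qr'_smul (q : ℚ) (x : QVec' n) : qr' (q • x) = (q : ℝ) • qr' x := by
  ext i; simp [qr']

theorem qr'_eq_zero {x : QVec' n} (h : qr' x = 0) : x = 0 := by
  ext i; simpa [qr'] using congrFun h i

theorem exists_norm_le_of_mem_convexHull (K : Finset (QVec' n)) :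
    ∃ R : ℝ, ∀ y ∈ convexHull ℚ (K : Set (QVec' n)), ‖qr' y‖ ≤ R := by
  obtain ⟨R, hR⟩ := (K.finite_toSet.image fun y => ‖qr' y‖).bddAbove
  refine ⟨R, fun y hy => convexHull_min (t := {y | ‖qr' y‖ ≤ R})
    (fun z hz => hR ⟨z, hz, rfl⟩) ?_ hy⟩
  intro y hy z hz a b ha hb hab
  have ha' : (0 : ℝ) ≤ a := by exact_mod_cast ha
  have hb' : (0 : ℝ) ≤ b := by exact_mod_cast hb
  have hab' : (a : ℝ) + b = 1 := by exact_mod_cast hab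
  rw [Set.mem_ofPred_eq] at hy hz ⊢
  calc ‖qr' (a • y + b • z)‖ ≤ ‖(a : ℝ) • qr' y‖ + ‖(b : ℝ) • qr' z‖ := by
        rw [qr'_add, qr'_smul, qr'_smul]
        exact norm_add_le _ _
    _ = a * ‖qr' y‖ + b * ‖qr' z‖ := by
        rw [norm_smul_of_nonneg ha', norm_smul_of_nonneg hb']
    _ ≤ a * R + b * R := by gcongr
    _ = R := by rw [← add_mul, hab', one_mul]

/-- Every real number is a limit of larger rationals, at any prescribed scale. -/
theorem exists_rat_sub_mul_le (b : ℝ) {ε N : ℝ} (hε : 0 < ε) (hN : 0 ≤ N) :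
    ∃ q : ℚ, b < q ∧ (q - b) * N ≤ ε := by
  have hN1 : 0 < N + 1 := by linarith
  obtain ⟨q, hq, hq'⟩ := exists_rat_btwn (show b < b + ε / (N + 1) by
    linarith [div_pos hε hN1])
  refine ⟨q, hq, ?_⟩
  have h1 : ((q : ℝ) - b) * (N + 1) ≤ ε :=
    (le_div_iff₀ hN1).1 (by linarith)
  nlinarith

theorem hausLim_recCone {P : Set (QVec' n)} (hP : IsRatPolyhedron P) (hne : P.Nonempty) :
    HausLim P (recCone P) := by
  obtain ⟨K, -, hK⟩ := exists_finset_convexHull_add_recCone hP hne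
  obtain ⟨R, hR⟩ := exists_norm_le_of_mem_convexHull K
  obtain ⟨x₀, hx₀⟩ := hne
  set L := max R ‖qr' x₀‖ + 1
  have hbound : ∀ a : ℝ, 0 < a →
      Metric.hausdorffEDist ((a • ·) '' Qr P) (Qr (recCone P)) ≤ ENNReal.ofReal (a * L) := by
    intro a ha
    refine Metric.hausdorffEDist_le_of_mem_edist ?_ ?_
    · rintro _ ⟨_, ⟨x, hx, rfl⟩, rfl⟩
      obtain ⟨y, hy, hr⟩ := hK x hx
      obtain ⟨q, haq, hq⟩ := exists_rat_sub_mul_le a ha (norm_nonneg (qr' (x - y)))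
      have hq0 : (0 : ℚ) ≤ q := by exact_mod_cast (ha.trans haq).le
      refine ⟨_, ⟨q • (x - y), smul_mem_recCone hr hq0, rfl⟩, ?_⟩
      rw [edist_dist]
      refine ENNReal.ofReal_le_ofReal ?_
      have hx' : qr' x = qr' y + qr' (x - y) := by rw [← qr'_add, add_sub_cancel]
      have heq : a • qr' x - qr' (q • (x - y)) =
          a • qr' y - ((q : ℝ) - a) • qr' (x - y) := by
        rw [qr'_smul, hx']
        module
      calc dist (a • qr' x) (qr' (q • (x - y)))
          ≤ ‖a • qr' y‖ + ‖((q : ℝ) - a) • qr' (x - y)‖ := by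
            rw [dist_eq_norm, heq]
            exact norm_sub_le _ _
        _ = a * ‖qr' y‖ + ((q : ℝ) - a) * ‖qr' (x - y)‖ := by
            rw [norm_smul_of_nonneg ha.le, norm_smul_of_nonneg (by linarith)]
        _ ≤ a * max R ‖qr' x₀‖ + a := by
            gcongr
            exact (hR y hy).trans (le_max_left _ _)
        _ = a * L := by ring
    · rintro _ ⟨r, hr, rfl⟩
      obtain ⟨q, haq, hq⟩ := exists_rat_sub_mul_le a⁻¹ one_pos (norm_nonneg (qr' r))
      have hq0 : (0 : ℚ) ≤ q := by exact_mod_cast ((inv_pos.2 ha).trans haq).le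
      refine ⟨_, ⟨_, ⟨_, hr x₀ hx₀ q hq0, rfl⟩, rfl⟩, ?_⟩
      rw [edist_dist]
      refine ENNReal.ofReal_le_ofReal ?_
      have heq : qr' r - a • qr' (x₀ + q • r) =
          -(a • (qr' x₀ + ((q : ℝ) - a⁻¹) • qr' r)) := by
        have h1 : qr' r = (a * a⁻¹) • qr' r := by rw [mul_inv_cancel₀ ha.ne', one_smul]
        rw [qr'_add, qr'_smul]
        nth_rewrite 1 [h1]
        module
      calc dist (qr' r) (a • qr' (x₀ + q • r))
          = a * ‖qr' x₀ + ((q : ℝ) - a⁻¹) • qr' r‖ := by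
            rw [dist_eq_norm, heq, norm_neg, norm_smul_of_nonneg ha.le]
        _ ≤ a * (‖qr' x₀‖ + ((q : ℝ) - a⁻¹) * ‖qr' r‖) := by
            rw [← norm_smul_of_nonneg (by linarith : 0 ≤ (q : ℝ) - a⁻¹)]
            gcongr
            exact norm_add_le _ _
        _ ≤ a * L := mul_le_mul_of_nonneg_left (add_le_add (le_max_right _ _) hq) ha.le
  have hlim : Filter.Tendsto (fun a : ℝ => ENNReal.ofReal (a * L))
      (nhdsWithin 0 (Set.Ioi 0)) (nhds 0) := by
    have : Filter.Tendsto (fun a : ℝ => ENNReal.ofReal (a * L)) (nhds 0)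
        (nhds (ENNReal.ofReal (0 * L))) :=
      (ENNReal.continuous_ofReal.comp (continuous_id.mul continuous_const)).tendsto 0
    rw [zero_mul, ENNReal.ofReal_zero] at this
    exact this.mono_left nhdsWithin_le_nhds
  exact tendsto_of_tendsto_of_tendsto_of_le_of_le' tendsto_const_nhds hlim
    (Filter.Eventually.of_forall fun _ => zero_le)
    (eventually_mem_nhdsWithin.mono fun a ha => hbound a ha)

theorem mem_of_qr'_mem_closure {s : Finset ((Fin n → ℤ) × ℚ)} {x : QVec' n}
    (hx : qr' x ∈ closure (Qr (solSet s))) : x ∈ solSet s := by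
  intro c hc
  have hcl : IsClosed {z : RVec' n | (c.2 : ℝ) ≤ ∑ i, (c.1 i : ℝ) * z i} :=
    isClosed_le continuous_const (by fun_prop)
  have hsub : Qr (solSet s) ⊆ {z : RVec' n | (c.2 : ℝ) ≤ ∑ i, (c.1 i : ℝ) * z i} := by
    rintro _ ⟨y, hy, rfl⟩
    simp only [Set.mem_ofPred_eq, qr']
    exact_mod_cast hy c hc
  have := closure_minimal hsub hcl hx
  simp only [Set.mem_ofPred_eq, qr'] at this
  exact_mod_cast this

theorem limCell_eq_recCone {P : Set (QVec' n)} (hP : IsRatPolyhedron P) (hne : P.Nonempty) :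
    limCell P = recCone P := by
  have hlim : Filter.Tendsto
      (fun a : ℝ => Metric.hausdorffEDist ((a • ·) '' Qr P) (Qr (recCone P)))
      (nhdsWithin 0 (Set.Ioi 0)) (nhds 0) := hausLim_recCone hP hne
  ext x
  constructor
  · intro hx
    have hx' : Filter.Tendsto (fun a : ℝ => Metric.infEDist (qr' x) ((a • ·) '' Qr P))
      (nhdsWithin 0 (Set.Ioi 0)) (nhds 0) := hx
    have hle : Metric.infEDist (qr' x) (Qr (recCone P)) ≤ 0 := by
      have hsum := hx'.add hlim
      rw [add_zero] at hsum
      exact ge_of_tendsto' hsum fun a => Metric.infEDist_le_infEDist_add_hausdorffEDist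
    obtain ⟨s, hs⟩ := isRatPolyhedron_recCone hP hne
    rw [hs] at hle ⊢
    exact mem_of_qr'_mem_closure
      (Metric.mem_closure_iff_infEDist_zero.2 (nonpos_iff_eq_zero.1 hle))
  · intro hx
    exact tendsto_of_tendsto_of_tendsto_of_le_of_le tendsto_const_nhds hlim
      (fun _ => zero_le) fun a => by
        change Metric.infEDist _ _ ≤ Metric.hausdorffEDist _ _
        rw [Metric.hausdorffEDist_comm]
        exact Metric.infEDist_le_hausdorffEDist_of_mem ⟨x, hx, rfl⟩

theorem recCone_eq_zero_of_isBounded {P : Set (QVec' n)} (hne : P.Nonempty)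
    (hb : Bornology.IsBounded (Qr P)) : recCone P = {0} := by
  refine Set.Subset.antisymm (fun r hr => ?_) (by simpa using zero_mem_recCone P)
  obtain ⟨x, hx⟩ := hne
  obtain ⟨R, hR⟩ := hb.exists_norm_le
  refine qr'_eq_zero (norm_le_zero_iff.1 ?_)
  by_contra! hpos
  obtain ⟨k, hk⟩ := exists_nat_gt ((R + ‖qr' x‖) / ‖qr' r‖)
  rw [div_lt_iff₀ hpos] at hk
  have h1 := hR _ ⟨_, hr x hx k k.cast_nonneg, rfl⟩
  have h2 : ‖((k : ℚ) : ℝ) • qr' r‖ = k * ‖qr' r‖ := by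
    rw [norm_smul_of_nonneg (by positivity), Rat.cast_natCast]
  have h3 := norm_sub_le (qr' (x + (k : ℚ) • r)) (qr' x)
  rw [qr'_add, qr'_smul, add_sub_cancel_left, h2, ← qr'_smul, ← qr'_add] at h3
  linarith

end HausdorffLimit

/-- Lemma 5.2: for every polyhedral decomposition `𝒫` of `ℚ^n`, the rescaled
Hausdorff limit `lim_{a→0⁺} a·Ξ` exists for every `Ξ ∈ 𝒫` (it is a point if `Ξ` is bounded
and a strongly convex rational polyhedral cone otherwise), and the asymptotic fan
`Σ_𝒫 = { lim_{a→0⁺} a·Ξ : Ξ ∈ 𝒫 }` is a complete fan in `ℚ^n`. -/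
theorem asymptotic_fan_complete (n : ℕ) (P : Set (Set (QVec' n))) (hP : IsPolyDecomp P) :
    (∀ Ξ ∈ P, HausLim Ξ (limCell Ξ) ∧
      (Bornology.IsBounded (Qr Ξ) → ∃ x, limCell Ξ = {x}) ∧
      (¬ Bornology.IsBounded (Qr Ξ) → IsStronglyConvexCone (limCell Ξ))) ∧
    IsCompleteFan (limCell '' P) := by
  have hlim : ∀ Ξ ∈ P, limCell Ξ = recCone Ξ := fun Ξ hΞ =>
    limCell_eq_recCone (hP.2.1 Ξ hΞ).1 (hP.2.1 Ξ hΞ).nonempty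
  refine ⟨fun Ξ hΞ => ?_, ?_⟩
  · have hsc := hP.2.1 Ξ hΞ
    rw [hlim Ξ hΞ]
    exact ⟨hausLim_recCone hsc.1 hsc.nonempty,
      fun hb => ⟨0, recCone_eq_zero_of_isBounded hsc.nonempty hb⟩,
      fun _ => isStronglyConvexCone_recCone hsc⟩
  · rw [Set.image_congr hlim]
    exact hP.isCompleteFan_recCone

end TropDisc
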